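/- Let q = 2^s with s ≥ 2, let α be a primitive element of GF(q^2), and λ = α^{q+1} (a primitive element of GF(q)). Let a = (1, λ^{2^{s-1}-1}, λ^{2(2^{s-1}-1)}, ..., λ^{q(2^{s-1}-1)}) and Ham(q,2,a) = { c ∈ GF(q)^{q+1} : Σ_{i=0}^{q} c_i a_i α^i = 0 }. Then the standardly extended code of Ham(q,2,a) is a [q+2, q-1, 4] MDS code over GF(q), and its dual is a [q+2, 3, q] MDS code. -/

import Mathlib

open Finset

variable {F : Type*} [Field F] [Fintype F] [DecidableEq F]

/-- The extended code of `C` by the vector `u`: append the coordinate `∑ uᵢ cᵢ`. -/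
def extCode {n : ℕ} (C : Submodule F (Fin n → F)) (u : Fin n → F) :
    Submodule F (Fin (n + 1) → F) where
  carrier := {x | (fun i => x i.castSucc) ∈ C ∧
    x (Fin.last n) = ∑ i, u i * x i.castSucc}
  add_mem' := by
    rintro a b ⟨ha, ha'⟩ ⟨hb, hb'⟩
    refine ⟨C.add_mem ha hb, ?_⟩
    simp only [Pi.add_apply, ha', hb', mul_add, Finset.sum_add_distrib]
  zero_mem' := ⟨C.zero_mem, by simp⟩
  smul_mem' := by
    rintro a x ⟨hx, hx'⟩
    refine ⟨C.smul_mem a hx, ?_⟩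
    simp only [Pi.smul_apply, smul_eq_mul, hx', Finset.mul_sum]
    exact Finset.sum_congr rfl fun i _ => by ring

/-- The (Euclidean) dual code. -/
def dualCode {n : ℕ} (C : Submodule F (Fin n → F)) : Submodule F (Fin n → F) where
  carrier := {x | ∀ c ∈ C, ∑ i, x i * c i = 0}
  add_mem' := by
    intro a b ha hb c hc
    simp only [Pi.add_apply, add_mul, Finset.sum_add_distrib, ha c hc, hb c hc, add_zero]
  zero_mem' := by intro c hc; simp
  smul_mem' := by
    intro a x hx c hc
    simp only [Pi.smul_apply, smul_eq_mul, mul_assoc, ← Finset.mul_sum, hx c hc, mul_zero]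

/-- Minimum (Hamming) distance of a linear code: least weight of a nonzero codeword. -/
noncomputable def minDist {n : ℕ} (C : Submodule F (Fin n → F)) : ℕ :=
  sInf {w | ∃ c ∈ C, c ≠ 0 ∧ hammingNorm c = w}

/-- Number of codewords of Hamming weight `w`. -/
noncomputable def weightCount {n : ℕ} (C : Submodule F (Fin n → F)) (w : ℕ) : ℕ :=
  Nat.card {c : C // hammingNorm (c : Fin n → F) = w}

section MDS

/-- The symmetric bilinear form `∑ xᵢ yᵢ` on `Fⁿ`. -/
noncomputable def euclideanForm (F : Type*) [Field F] (n : ℕ) :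
    LinearMap.BilinForm F (Fin n → F) :=
  Matrix.toBilin' 1

lemma euclideanForm_apply {F : Type*} [Field F] {n : ℕ} (x y : Fin n → F) :
    euclideanForm F n x y = ∑ i, x i * y i := by
  simp [euclideanForm, Matrix.toBilin'_apply', dotProduct]

lemma euclideanForm_nondegenerate (F : Type*) [Field F] (n : ℕ) :
    (euclideanForm F n).Nondegenerate :=
  LinearMap.BilinForm.nondegenerate_toBilin'_of_det_ne_zero' _ (by simp)

lemma euclideanForm_isRefl (F : Type*) [Field F] (n : ℕ) : (euclideanForm F n).IsRefl := by
  intro x y h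
  rw [euclideanForm_apply] at h ⊢
  simpa only [mul_comm] using h

lemma mem_dualCode_iff {F : Type*} [Field F] [Fintype F] [DecidableEq F] {n : ℕ}
    {C : Submodule F (Fin n → F)} {x : Fin n → F} :
    x ∈ dualCode C ↔ ∀ c ∈ C, ∑ i, x i * c i = 0 := Iff.rfl

lemma dualCode_eq_orthogonal {F : Type*} [Field F] [Fintype F] [DecidableEq F] {n : ℕ}
    (C : Submodule F (Fin n → F)) : dualCode C = (euclideanForm F n).orthogonal C := by
  ext x
  rw [LinearMap.BilinForm.mem_orthogonal_iff, mem_dualCode_iff]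
  refine forall₂_congr fun c _ => ?_
  rw [euclideanForm_apply]
  simp only [mul_comm]

lemma dualCode_dualCode {F : Type*} [Field F] [Fintype F] [DecidableEq F] {n : ℕ}
    (C : Submodule F (Fin n → F)) : dualCode (dualCode C) = C := by
  rw [dualCode_eq_orthogonal, dualCode_eq_orthogonal]
  exact LinearMap.BilinForm.orthogonal_orthogonal (euclideanForm_nondegenerate F n)
    (euclideanForm_isRefl F n) C

lemma finrank_dualCode {F : Type*} [Field F] [Fintype F] [DecidableEq F] {n : ℕ}
    (C : Submodule F (Fin n → F)) :
    Module.finrank F (dualCode C) = n - Module.finrank F C := by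
  rw [dualCode_eq_orthogonal,
    LinearMap.BilinForm.finrank_orthogonal (euclideanForm_nondegenerate F n), Module.finrank_fin_fun]

/-- The restriction of codewords to a set of coordinates. -/
def puncture {F : Type*} [Field F] {n : ℕ} (C : Submodule F (Fin n → F)) (T : Finset (Fin n)) :
    C →ₗ[F] (T → F) :=
  LinearMap.funLeft F F (fun i : T => (i : Fin n)) ∘ₗ C.subtype

lemma hammingNorm_add_card_le {F : Type*} [Field F] [DecidableEq F] {n : ℕ} {c : Fin n → F}
    {T : Finset (Fin n)} (h : ∀ i ∈ T, c i = 0) : hammingNorm c + #T ≤ n := by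
  have hsub : univ.filter (fun i => c i ≠ 0) ⊆ Tᶜ := by
    intro i hi
    rw [mem_compl]
    exact fun hT => (mem_filter.1 hi).2 (h i hT)
  have hle := card_le_card hsub
  have hT := card_le_univ T
  rw [card_compl] at hle
  rw [Fintype.card_fin] at hle hT
  unfold hammingNorm
  omega

lemma exists_hammingNorm_add_finrank_le {F : Type*} [Field F] [DecidableEq F] {n : ℕ}
    (C : Submodule F (Fin n → F)) (hC : 0 < Module.finrank F C) :
    ∃ c ∈ C, c ≠ 0 ∧ hammingNorm c + Module.finrank F C ≤ n + 1 := by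
  have hn : Module.finrank F C ≤ n := by simpa using C.finrank_le
  obtain ⟨T, -, hT⟩ := exists_subset_card_eq
    (s := (univ : Finset (Fin n))) (n := Module.finrank F C - 1) (by simp; omega)
  have hker : LinearMap.ker (puncture C T) ≠ ⊥ :=
    LinearMap.ker_ne_bot_of_finrank_lt (by simp [hT]; omega)
  obtain ⟨c, hc, hc0⟩ := Submodule.exists_mem_ne_zero_of_ne_bot hker
  refine ⟨c, c.2, by simpa using hc0, ?_⟩
  have := hammingNorm_add_card_le (c := (c : Fin n → F)) (T := T)
    fun i hi => congrFun (LinearMap.mem_ker.1 hc) ⟨i, hi⟩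
  omega

lemma minDist_add_finrank_eq {F : Type*} [Field F] [Fintype F] [DecidableEq F] {n : ℕ}
    (C : Submodule F (Fin n → F)) (hC : 0 < Module.finrank F C)
    (h : ∀ c ∈ C, c ≠ 0 → n + 1 ≤ hammingNorm c + Module.finrank F C) :
    minDist C + Module.finrank F C = n + 1 := by
  obtain ⟨c, hc, hc0, hle⟩ := exists_hammingNorm_add_finrank_le C hC
  have hne : {w | ∃ c ∈ C, c ≠ 0 ∧ hammingNorm c = w}.Nonempty := ⟨_, c, hc, hc0, rfl⟩
  obtain ⟨b, hb, hb0, hbw⟩ := Nat.sInf_mem hne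
  have hmin : minDist C ≤ hammingNorm c := Nat.sInf_le ⟨c, hc, hc0, rfl⟩
  have hb' := h b hb hb0
  rw [hbw] at hb'
  change n + 1 ≤ minDist C + _ at hb'
  omega

lemma finrank_lt_hammingNorm_of_mem_dualCode {F : Type*} [Field F] [Fintype F] [DecidableEq F]
    {n : ℕ} (D : Submodule F (Fin n → F))
    (h : ∀ d ∈ D, d ≠ 0 → n + 1 ≤ hammingNorm d + Module.finrank F D)
    {c : Fin n → F} (hc : c ∈ dualCode D) (hc0 : c ≠ 0) :
    Module.finrank F D < hammingNorm c := by
  by_contra! hlt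
  have hn : Module.finrank F D ≤ n := by simpa using D.finrank_le
  obtain ⟨T, hsub, hT⟩ := exists_superset_card_eq (s := univ.filter (fun i => c i ≠ 0))
    (n := Module.finrank F D) hlt (by simpa using hn)
  have hinj : Function.Injective (puncture D T) := by
    rw [← LinearMap.ker_eq_bot, LinearMap.ker_eq_bot']
    intro d hd
    by_contra hd0
    have h1 := hammingNorm_add_card_le (c := (d : Fin n → F)) (T := T)
      fun i hi => congrFun hd ⟨i, hi⟩
    have h2 := h d d.2 (by simpa using hd0)
    omega
  have hsurj := (LinearMap.injective_iff_surjective_of_finrank_eq_finrank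
    (by simp [hT])).1 hinj
  refine hc0 (funext fun i => ?_)
  by_contra hi
  have hiT : i ∈ T := hsub (by simpa using hi)
  obtain ⟨d, hd⟩ := hsurj (Pi.single ⟨i, hiT⟩ 1)
  have hsum := hc d d.2
  rw [sum_eq_single i] at hsum
  · have : (d : Fin n → F) i = 1 := (congrFun hd ⟨i, hiT⟩).trans (by simp)
    rw [this, mul_one] at hsum
    exact hi hsum
  · intro j _ hji
    by_cases hj : j ∈ T
    · have : (d : Fin n → F) j = 0 :=
        (congrFun hd ⟨j, hj⟩).trans (by simp [hji])
      rw [this, mul_zero]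
    · have : c j = 0 := by
        by_contra hcj
        exact hj (hsub (by simpa using hcj))
      rw [this, zero_mul]
  · simp

end MDS

section TraceCode

/-- The encoder `(u, t) ↦ (Tr(u v₀) + t, …, Tr(u vₙ₋₁) + t, t)`. -/
noncomputable def traceEncoder {F K : Type*} [Field F] [Field K] [Algebra F K] {n : ℕ}
    (v : Fin n → K) : K × F →ₗ[F] (Fin (n + 1) → F) :=
  LinearMap.pi (Fin.snoc (α := fun _ => K × F →ₗ[F] F)
    (fun i => Algebra.trace F K ∘ₗ LinearMap.mulRight F (v i) ∘ₗ LinearMap.fst F K F +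
      LinearMap.snd F K F) (LinearMap.snd F K F))

@[simp]
lemma traceEncoder_castSucc {F K : Type*} [Field F] [Field K] [Algebra F K] {n : ℕ}
    (v : Fin n → K) (u : K) (t : F) (i : Fin n) :
    traceEncoder v (u, t) i.castSucc = Algebra.trace F K (u * v i) + t := by
  simp [traceEncoder]

@[simp]
lemma traceEncoder_last {F K : Type*} [Field F] [Field K] [Algebra F K] {n : ℕ}
    (v : Fin n → K) (u : K) (t : F) : traceEncoder v (u, t) (Fin.last n) = t := by
  simp [traceEncoder]

lemma sum_mul_traceEncoder {F K : Type*} [Field F] [Field K] [Algebra F K] {n : ℕ}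
    (v : Fin n → K) (u : K) (t : F) (x : Fin (n + 1) → F) :
    ∑ i, x i * traceEncoder v (u, t) i =
      Algebra.trace F K (u * ∑ i : Fin n, x i.castSucc • v i) +
        (∑ i : Fin n, x i.castSucc + x (Fin.last n)) * t := by
  simp only [Fin.sum_univ_castSucc, traceEncoder_castSucc, traceEncoder_last, mul_sum, map_sum,
    mul_smul_comm, map_smul, smul_eq_mul, mul_add, add_mul, sum_add_distrib, sum_mul]
  ring

lemma extCode_eq_dualCode_range {F K : Type*} [Field F] [Fintype F] [DecidableEq F] [Field K]
    [Finite K] [Algebra F K] {n : ℕ} (v : Fin n → K) (C : Submodule F (Fin n → F))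
    (hC : ∀ c, c ∈ C ↔ ∑ i, c i • v i = 0) :
    extCode C (fun _ => -1) = dualCode (LinearMap.range (traceEncoder (F := F) v)) := by
  ext x
  have hext : x ∈ extCode C (fun _ => -1) ↔
      ∑ i : Fin n, x i.castSucc • v i = 0 ∧ ∑ i : Fin n, x i.castSucc + x (Fin.last n) = 0 := by
    change ((fun i => x (Fin.castSucc i)) ∈ C ∧ x (Fin.last n) = _) ↔ _
    rw [hC]
    simp only [neg_mul, one_mul, sum_neg_distrib, eq_neg_iff_add_eq_zero,
      add_comm (x (Fin.last n))]
  have hdual : x ∈ dualCode (LinearMap.range (traceEncoder (F := F) v)) ↔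
      ∀ (u : K) (t : F), Algebra.trace F K (u * ∑ i : Fin n, x i.castSucc • v i) +
        (∑ i : Fin n, x i.castSucc + x (Fin.last n)) * t = 0 := by
    rw [mem_dualCode_iff]
    simp only [← SetLike.mem_coe, LinearMap.coe_range, Set.forall_mem_range, Prod.forall,
      sum_mul_traceEncoder]
  rw [hext, hdual]
  constructor
  · rintro ⟨h1, h2⟩ u t
    simp [h1, h2]
  · intro h
    refine ⟨?_, by simpa using h 0 1⟩
    have hnd := traceForm_nondegenerate F K
    refine hnd.1 _ fun u => ?_
    rw [Algebra.traceForm_apply, mul_comm]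
    simpa using h u 0

lemma algebraMap_trace_of_card_eq_sq {F K : Type*} [Field F] [Fintype F] [Field K] [Fintype K]
    [Algebra F K] {q : ℕ} (hF : Fintype.card F = q) (hfin : Module.finrank F K = 2) (x : K) :
    algebraMap F K (Algebra.trace F K x) = x + x ^ q := by
  rw [FiniteField.algebraMap_trace_eq_sum_pow, hfin, Nat.card_eq_fintype_card, hF]
  simp [sum_range_succ]

/-- A line meets the set of norm-one elements in at most two points, and a line through the
origin in at most one. -/
lemma eq_zero_of_trace_add_eq_zero {F K : Type*} [Field F] [Fintype F] [Field K] [Fintype K]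
    [Algebra F K] {q : ℕ} (hF : Fintype.card F = q) (hfin : Module.finrank F K = 2)
    {x y u : K} {t : F} (hx : x ^ (q + 1) = 1) (hy : y ^ (q + 1) = 1) (hxy : x ≠ y)
    (htx : Algebra.trace F K (u * x) + t = 0) (hty : Algebra.trace F K (u * y) + t = 0) :
    u * (x + y) + algebraMap F K t = 0 := by
  have key : ∀ z : K, z ^ (q + 1) = 1 → Algebra.trace F K (u * z) + t = 0 →
      u * z ^ 2 + algebraMap F K t * z + u ^ q = 0 := by
    intro z hz htz
    have h := congrArg (algebraMap F K) htz
    rw [map_add, algebraMap_trace_of_card_eq_sq hF hfin, map_zero, mul_pow] at h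
    rw [pow_succ] at hz
    linear_combination z * h - u ^ q * hz
  refine mul_left_cancel₀ (sub_ne_zero.2 hxy) ?_
  linear_combination key x hx htx - key y hy hty

lemma card_le_two_of_traceEncoder_eq_zero {F K : Type*} [Field F] [Fintype F] [Field K]
    [Fintype K] [CharP K 2] [Algebra F K] {q n : ℕ} (hF : Fintype.card F = q)
    (hfin : Module.finrank F K = 2) {v : Fin n → K} (hv : Function.Injective v)
    (hv1 : ∀ i, v i ^ (q + 1) = 1) {u : K} {t : F} (hut : (u, t) ≠ 0)
    {T : Finset (Fin (n + 1))} (hT : ∀ i ∈ T, traceEncoder v (u, t) i = 0) : #T ≤ 2 := by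
  by_contra! hcard
  obtain ⟨i, hi, j, hj, k, hk, hij, hik, hjk⟩ := two_lt_card.1 hcard
  have hline : ∀ a b : Fin n, a ≠ b → a.castSucc ∈ T → b.castSucc ∈ T →
      u * (v a + v b) + algebraMap F K t = 0 := fun a b hab ha hb =>
    eq_zero_of_trace_add_eq_zero hF hfin (hv1 a) (hv1 b) (hv.ne hab)
      (by simpa using hT _ ha) (by simpa using hT _ hb)
  have hlast : ∀ a b : Fin n, a ≠ b → a.castSucc ∈ T → b.castSucc ∈ T → Fin.last n ∉ T := by
    intro a b hab ha hb hl
    have ht : t = 0 := by simpa using hT _ hl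
    have h := hline a b hab ha hb
    rw [ht, map_zero, add_zero, mul_eq_zero, CharTwo.add_eq_zero] at h
    rcases h with h | h
    · exact hut (by rw [h, ht]; rfl)
    · exact hab (hv h)
  induction i using Fin.lastCases with
  | last =>
    induction j using Fin.lastCases with
    | last => exact hij rfl
    | cast j =>
      induction k using Fin.lastCases with
      | last => exact hik rfl
      | cast k => exact hlast j k (by rintro rfl; exact hjk rfl) hj hk hi
  | cast i =>
    induction j using Fin.lastCases with
    | last =>
      induction k using Fin.lastCases with
      | last => exact hjk rfl
      | cast k => exact hlast i k (by rintro rfl; exact hik rfl) hi hk hj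
    | cast j =>
      have hij' : i ≠ j := by rintro rfl; exact hij rfl
      induction k using Fin.lastCases with
      | last => exact hlast i j hij' hi hj hk
      | cast k =>
        have hik' : i ≠ k := by rintro rfl; exact hik rfl
        have hjk' : j ≠ k := by rintro rfl; exact hjk rfl
        have h1 := hline i j hij' hi hj
        have h2 := hline i k hik' hi hk
        have hu : u * (v j - v k) = 0 := by linear_combination h1 - h2
        have hu0 : u = 0 := (mul_eq_zero.1 hu).resolve_right (sub_ne_zero.2 (hv.ne hjk'))
        have ht : t = 0 := by
          have := hT _ hi
          simpa [hu0] using this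
        exact hut (by rw [hu0, ht]; rfl)

end TraceCode

/-- the standardly extended code of the Hamming code
`Ham(q,2,a)` with `a = (λ^{i(2^{s-1}-1)})_i`, `q = 2^s`, is a `[q+2, q-1, 4]`
MDS code whose dual is a `[q+2, 3, q]` MDS code. -/
theorem stmt15 {F K : Type*} [Field F] [Fintype F] [DecidableEq F]
    [Field K] [Fintype K] [Algebra F K]
    (q s : ℕ) (hq : q = 2 ^ s) (hs : 2 ≤ s)
    (hF : Fintype.card F = q) (hK : Fintype.card K = q ^ 2)
    (α : K) (hα : IsPrimitiveRoot α (q ^ 2 - 1))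
    (lam : F) (hlam : algebraMap F K lam = α ^ (q + 1))
    (a : Fin (q + 1) → F)
    (ha : ∀ i, a i = lam ^ ((i : ℕ) * (2 ^ (s - 1) - 1)))
    (C : Submodule F (Fin (q + 1) → F))
    (hC : ∀ c, c ∈ C ↔ ∑ i, algebraMap F K (a i * c i) * α ^ (i : ℕ) = 0) :
    Module.finrank F (extCode C (fun _ => -1)) = q - 1 ∧
    minDist (extCode C (fun _ => -1)) = 4 ∧
    Module.finrank F (dualCode (extCode C (fun _ => -1))) = 3 ∧
    minDist (dualCode (extCode C (fun _ => -1))) = q := by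
  have hcards : q ^ 2 = q ^ Module.finrank F K := by
    rw [← hK, ← hF]; exact Module.card_eq_pow_finrank
  have hq4 : 4 ≤ q := by
    rw [hq]; exact Nat.pow_le_pow_right (n := 2) (by norm_num) hs
  have hfin : Module.finrank F K = 2 := (Nat.pow_right_injective (by omega) hcards).symm
  have : CharP K 2 := by
    have : Fact (Nat.Prime 2) := ⟨Nat.prime_two⟩
    refine charP_of_card_eq_prime_pow (f := s * 2) ?_
    rw [hK, hq, ← pow_mul]
  obtain ⟨m, hm⟩ : ∃ m, 2 ^ (s - 1) = m + 1 := Nat.exists_eq_succ_of_ne_zero (by positivity)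
  have hqm : q = 2 * (m + 1) := by
    rw [hq, ← hm, ← pow_succ', Nat.sub_add_cancel (by omega)]
  have hβ : IsPrimitiveRoot (α ^ ((q - 1) * (m + 1))) (q + 1) := by
    rw [pow_mul]
    refine (hα.pow ?_ ?_).pow_of_coprime (m + 1) ?_
    · rw [Nat.sub_pos_iff_lt]; nlinarith
    · rw [← one_pow 2, Nat.sq_sub_sq, mul_comm, one_pow]
    · rw [hqm]; simp
  have hβv : ∀ i : Fin (q + 1),
      algebraMap F K (a i) * α ^ (i : ℕ) = (α ^ ((q - 1) * (m + 1))) ^ (i : ℕ) := by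
    intro i
    rw [ha, hm, map_pow, hlam, ← pow_mul, ← pow_mul, ← pow_add]
    congr 1
    generalize (i : ℕ) = i
    rw [hqm, Nat.add_sub_cancel, show 2 * (m + 1) - 1 = 2 * m + 1 by omega]
    ring
  set v : Fin (q + 1) → K := fun i => (α ^ ((q - 1) * (m + 1))) ^ (i : ℕ) with hvdef
  have hv : Function.Injective v := fun i j h => Fin.ext (hβ.pow_inj i.2 j.2 h)
  have hv1 : ∀ i, v i ^ (q + 1) = 1 := fun i => by
    rw [hvdef, pow_right_comm, hβ.pow_eq_one, one_pow]
  have hCv : ∀ c, c ∈ C ↔ ∑ i, c i • v i = 0 := by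
    intro c
    rw [hC]
    refine Eq.congr (sum_congr rfl fun i _ => ?_) rfl
    rw [Algebra.smul_def, map_mul]
    linear_combination algebraMap F K (c i) * hβv i
  rw [extCode_eq_dualCode_range v C hCv, dualCode_dualCode]
  have hweight : ∀ p : K × F, p ≠ 0 → q ≤ hammingNorm (traceEncoder v p) := by
    rintro ⟨u, t⟩ hp
    have h := card_le_two_of_traceEncoder_eq_zero hF hfin hv hv1 hp
      (T := univ.filter fun i => traceEncoder v (u, t) i = 0) (by simp)
    have hsum := card_filter_add_card_filter_not (s := univ)
      (fun i => traceEncoder v (u, t) i = 0)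
    rw [card_univ, Fintype.card_fin] at hsum
    unfold hammingNorm
    simp only [ne_eq]
    omega
  have hinj : Function.Injective (traceEncoder (F := F) v) := by
    rw [← LinearMap.ker_eq_bot, LinearMap.ker_eq_bot']
    intro p hp
    by_contra hp0
    have := hweight p hp0
    rw [hp, hammingNorm_zero] at this
    omega
  set D := LinearMap.range (traceEncoder (F := F) v)
  have hD : Module.finrank F D = 3 := by
    rw [LinearMap.finrank_range_of_inj hinj, Module.finrank_prod, hfin, Module.finrank_self]
  have hDmds : ∀ d ∈ D, d ≠ 0 → q + 1 + 1 + 1 ≤ hammingNorm d + Module.finrank F D := by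
    rintro _ ⟨p, rfl⟩ hp
    have := hweight p (by rintro rfl; exact hp (map_zero _))
    omega
  have hE : Module.finrank F (dualCode D) = q - 1 := by
    rw [finrank_dualCode, hD]; omega
  refine ⟨hE, ?_, hD, ?_⟩
  · have := minDist_add_finrank_eq (dualCode D) (by omega) fun c hc hc0 => by
      have := finrank_lt_hammingNorm_of_mem_dualCode D hDmds hc hc0
      omega
    omega
  · have := minDist_add_finrank_eq D (by omega) hDmds
    omega
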